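/- arXiv:2302.12230 — 2 statements merged into one kernel-verified Lean document; each statement's English description precedes it below -/
import Mathlib

section
/- Let t > u be positive integers of the same parity, and define the 4×4 matrices M = [[0,t,t,3],[t,0,3,t],[t,3,0,t],[3,t,t,0]] and M' = [[0,u,u,1],[u,0,−3,u],[u,−3,0,u],[1,u,u,0]], and let β = (t−u)/(2t). Suppose (5/6)·t ≤ u ≤ t − 56√t − 62. Then: (a) λ₁(M') = 2√(u²+1) − 1; (b) there exists a connected graph lift G₀ of M on 4t vertices with λ₂(A_{G₀}) ≤ λ₁(M'); and (c) (M, M', β) ∈ ℳ. -/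
/-- The adjacency matrix of a finite simple graph, with real entries. -/
noncomputable def adjMat {V : Type*} [Fintype V] (G : SimpleGraph V) : Matrix V V ℝ :=
  letI := Classical.decRel G.Adj
  G.adjMatrix ℝ

/-- The eigenvalues of a real (symmetric) matrix, i.e. the real roots of its characteristic
polynomial with multiplicity, listed in decreasing order. -/
noncomputable def eigList {V : Type*} [Fintype V] [DecidableEq V] (A : Matrix V V ℝ) : List ℝ :=
  (A.charpoly.roots.sort (· ≤ ·)).reverse

/-- `lam A i` is `λ_i(A)`, the `i`-th largest eigenvalue (counted with multiplicity, 1-indexed)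
of a real symmetric matrix `A`. -/
noncomputable def lam {V : Type*} [Fintype V] [DecidableEq V] (A : Matrix V V ℝ) (i : ℕ) : ℝ :=
  (eigList A).getD (i - 1) 0

/-- A nonnegative square matrix is irreducible iff the associated (multi)graph is connected:
between any two distinct indices there is a walk. -/
def Irred {k : ℕ} (M : Matrix (Fin k) (Fin k) ℕ) : Prop :=
  ∀ i j, i ≠ j → ∃ n : ℕ, 0 < (M ^ n) i j

/-- A graph lift of a symmetric nonnegative integer matrix `M` with zero diagonal: a
`k`-partite graph `G`, with parts `V_i = P⁻¹(i)`, such that for `i ≠ j` the bipartite graph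
between `V_i` and `V_j` is `M i j`-regular. -/
structure IsGraphLift {V : Type*} [Fintype V] {k : ℕ} (M : Matrix (Fin k) (Fin k) ℕ)
    (G : SimpleGraph V) (P : V → Fin k) : Prop where
  parts_cover : Function.Surjective P
  not_adj_within : ∀ v w, G.Adj v w → P v ≠ P w
  between_regular : ∀ (v : V) (j : Fin k), j ≠ P v →
    {w : V | G.Adj v w ∧ P w = j}.ncard = M (P v) j

/-- `M'` is a sign matrix of `M`: a symmetric integer matrix with `M' i j ≡ M i j (mod 2)`
and `|M' i j| ≤ M i j` for all `i, j`. -/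
def IsSignMatrix {k : ℕ} (M : Matrix (Fin k) (Fin k) ℕ) (M' : Matrix (Fin k) (Fin k) ℤ) :
    Prop :=
  M'.IsSymm ∧ ∀ i j, (2 : ℤ) ∣ (M' i j - (M i j : ℤ)) ∧ |M' i j| ≤ (M i j : ℤ)

/-- A natural number matrix viewed as a real matrix. -/
def natToReal {k : ℕ} (M : Matrix (Fin k) (Fin k) ℕ) : Matrix (Fin k) (Fin k) ℝ :=
  Matrix.of fun i j => (M i j : ℝ)

/-- An integer matrix viewed as a real matrix. -/
def intToReal {k : ℕ} (M' : Matrix (Fin k) (Fin k) ℤ) : Matrix (Fin k) (Fin k) ℝ :=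
  Matrix.of fun i j => (M' i j : ℝ)

/-- The matrix `D = (M - M')/2`. -/
noncomputable def DMat {k : ℕ} (M : Matrix (Fin k) (Fin k) ℕ)
    (M' : Matrix (Fin k) (Fin k) ℤ) : Matrix (Fin k) (Fin k) ℝ :=
  (1 / 2 : ℝ) • (natToReal M - intToReal M')

/-- Entrywise absolute value of a real matrix. -/
def absMat {k : ℕ} (A : Matrix (Fin k) (Fin k) ℝ) : Matrix (Fin k) (Fin k) ℝ :=
  Matrix.of fun i j => |A i j|

/-- `σ = Σ_{i,j} √(M_{ij})`. -/
noncomputable def sigmaM {k : ℕ} (M : Matrix (Fin k) (Fin k) ℕ) : ℝ :=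
  ∑ i, ∑ j, Real.sqrt (M i j)

/-- The set `ℳ` of triples `(M, M', β)`: `M` is an irreducible symmetric nonnegative integer
matrix with zero diagonal, `M'` is a sign matrix of `M`, `β ∈ (0, 1/2)`, and (with
`D = (M - M')/2`, `γ = λ₁(|D - βM|)`, `σ = Σ_{i,j} √(M_{ij})`) the matrix
`[[(1-2β)λ₁(M') + 2γ + 7σ, 2λ₁(D)], [2λ₁(D), 2λ₁(D) + σ]]` has top eigenvalue at most
`λ₁(M')`. -/
structure MemM {k : ℕ} (M : Matrix (Fin k) (Fin k) ℕ) (M' : Matrix (Fin k) (Fin k) ℤ)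
    (β : ℝ) : Prop where
  symm : M.IsSymm
  diag : ∀ i, M i i = 0
  irr : Irred M
  signMatrix : IsSignMatrix M M'
  beta_mem : β ∈ Set.Ioo (0 : ℝ) (1 / 2)
  eig_cond :
    lam !![(1 - 2 * β) * lam (intToReal M') 1 +
             2 * lam (absMat (DMat M M' - β • natToReal M)) 1 + 7 * sigmaM M,
           2 * lam (DMat M M') 1;
           2 * lam (DMat M M') 1,
           2 * lam (DMat M M') 1 + sigmaM M] 1 ≤ lam (intToReal M') 1

/-- The matrix `M` of Lemma 5.8. -/
def MLift (t : ℕ) : Matrix (Fin 4) (Fin 4) ℕ :=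
  !![0, t, t, 3;
     t, 0, 3, t;
     t, 3, 0, t;
     3, t, t, 0]

/-- The matrix `M'` of Lemma 5.8. -/
def MLift' (u : ℕ) : Matrix (Fin 4) (Fin 4) ℤ :=
  !![0, (u : ℤ), (u : ℤ), 1;
     (u : ℤ), 0, -3, (u : ℤ);
     (u : ℤ), -3, 0, (u : ℤ);
     1, (u : ℤ), (u : ℤ), 0]


lemma eigList_pairwise {V : Type*} [Fintype V] [DecidableEq V] (A : Matrix V V ℝ) :
    (eigList A).Pairwise (· ≥ ·) := by
  unfold eigList
  rw [List.pairwise_reverse]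
  exact Multiset.pairwise_sort _ _

lemma mem_eigList {V : Type*} [Fintype V] [DecidableEq V] (A : Matrix V V ℝ) (x : ℝ) :
    x ∈ eigList A ↔ (Matrix.scalar V x - A).det = 0 := by
  unfold eigList
  rw [List.mem_reverse, Multiset.mem_sort, Polynomial.mem_roots (Matrix.charpoly_monic A).ne_zero,
    Polynomial.IsRoot.def, Matrix.eval_charpoly]

lemma lam_le {V : Type*} [Fintype V] [DecidableEq V] (A : Matrix V V ℝ) (i : ℕ) (c : ℝ)
    (hc : 0 ≤ c) (h : ∀ x, (Matrix.scalar V x - A).det = 0 → x ≤ c) : lam A i ≤ c := by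
  unfold lam
  by_cases hi : i - 1 < (eigList A).length
  · rw [List.getD_eq_getElem _ _ hi]
    exact h _ ((mem_eigList A _).1 (List.getElem_mem hi))
  · rw [List.getD_eq_default _ _ (by omega)]
    exact hc

lemma lam_one_eq {V : Type*} [Fintype V] [DecidableEq V] (A : Matrix V V ℝ) (c : ℝ)
    (hm : (Matrix.scalar V c - A).det = 0)
    (h : ∀ x, (Matrix.scalar V x - A).det = 0 → x ≤ c) : lam A 1 = c := by
  have hm' := (mem_eigList A c).2 hm
  have h' : ∀ x ∈ eigList A, x ≤ c := fun x hx => h x ((mem_eigList A x).1 hx)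
  have hp := eigList_pairwise A
  unfold lam
  revert hm' h' hp
  cases eigList A with
  | nil => simp
  | cons a l =>
    intro hm' h' hp
    simp only [Nat.sub_self, List.getD_cons_zero]
    apply le_antisymm (h' a (by simp))
    rcases List.mem_cons.1 hm' with h1 | h1
    · exact h1.le
    · exact (List.pairwise_cons.1 hp).1 c h1

def NMat (a b c : ℝ) : Matrix (Fin 4) (Fin 4) ℝ :=
  !![0, a, a, b; a, 0, c, a; a, c, 0, a; b, a, a, 0]

lemma NMat_det (a b c x : ℝ) : (Matrix.scalar (Fin 4) x - NMat a b c).det =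
    (x + b) * (x + c) * ((x - b) * (x - c) - 4 * a ^ 2) := by
  have : Matrix.scalar (Fin 4) x - NMat a b c =
      !![x, -a, -a, -b; -a, x, -c, -a; -a, -c, x, -a; -b, -a, -a, x] := by
    ext i j
    fin_cases i <;> fin_cases j <;> simp [NMat, Matrix.scalar_apply]
  rw [this]
  simp [Matrix.det_succ_row_zero, Fin.sum_univ_succ, Fin.succAbove]
  ring

lemma NMat_lam (a b c r : ℝ) (hr : (r - b) * (r - c) = 4 * a ^ 2) (h1 : b ≤ r) (h2 : c ≤ r)
    (h3 : -b ≤ r) (h4 : -c ≤ r) : lam (NMat a b c) 1 = r := by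
  apply lam_one_eq
  · rw [NMat_det, hr]; ring
  · intro x hx
    rw [NMat_det] at hx
    rcases mul_eq_zero.1 hx with h | h
    · rcases mul_eq_zero.1 h with h | h <;> linarith
    · by_contra hlt
      push Not at hlt
      nlinarith [mul_nonneg (sub_nonneg.2 h1) (sub_nonneg.2 hlt.le),
        mul_nonneg (sub_nonneg.2 h2) (sub_nonneg.2 hlt.le), mul_pos (sub_pos.2 hlt) (sub_pos.2 hlt)]

lemma two_lam (a b c r : ℝ) (h0 : 0 ≤ r) (h1 : a ≤ r) (h2 : c ≤ r)
    (h : b ^ 2 ≤ (r - a) * (r - c)) : lam !![a, b; b, c] 1 ≤ r := by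
  apply lam_le _ _ _ h0
  intro x hx
  have : (x - a) * (x - c) - b * b = 0 := by
    rw [← hx]; simp [Matrix.det_fin_two, Matrix.scalar_apply]
  by_contra hlt
  push Not at hlt
  nlinarith [mul_nonneg (sub_nonneg.2 h1) (sub_nonneg.2 hlt.le),
    mul_nonneg (sub_nonneg.2 h2) (sub_nonneg.2 hlt.le), mul_pos (sub_pos.2 hlt) (sub_pos.2 hlt)]

lemma eigList_eq {V : Type*} [Fintype V] [DecidableEq V] (A : Matrix V V ℝ) (hA : A.IsHermitian) :
    eigList A = List.ofFn hA.eigenvalues₀ := by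
  have hperm : (eigList A).Perm (List.ofFn hA.eigenvalues₀) := by
    rw [← Multiset.coe_eq_coe]
    have : ((eigList A : List ℝ) : Multiset ℝ) = A.charpoly.roots := by
      unfold eigList
      rw [Multiset.coe_reverse, Multiset.sort_eq]
    rw [this, hA.roots_charpoly_eq_eigenvalues₀, Fin.univ_val_map]
    rfl
  refine hperm.eq_of_pairwise ?_ (eigList_pairwise A) ?_
  · intro a b _ _ h1 h2
    exact le_antisymm h2 h1
  · exact (hA.eigenvalues₀_antitone.sortedGE_ofFn).pairwise

open Matrix in
lemma lam_two_le {V : Type*} [Fintype V] [DecidableEq V] (A : Matrix V V ℝ) (hA : A.IsHermitian)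
    (c : ℝ) (hc : 0 ≤ c)
    (h : ∀ x : V → ℝ, ∑ v, x v = 0 → x ⬝ᵥ (A *ᵥ x) ≤ c * (x ⬝ᵥ x)) : lam A 2 ≤ c := by
  unfold lam
  rw [eigList_eq A hA]
  by_cases hi : 1 < Fintype.card V
  swap
  · rw [List.getD_eq_default _ _ (by simp; omega)]
    exact hc
  rw [List.getD_eq_getElem _ _ (by simpa using hi)]
  simp only [List.getElem_ofFn]
  set e : Fin (Fintype.card V) ≃ V := Fintype.equivOfCardEq (Fintype.card_fin _) with he
  have hev : ∀ k, hA.eigenvalues (e k) = hA.eigenvalues₀ k := by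
    intro k
    unfold Matrix.IsHermitian.eigenvalues
    rw [← he, Equiv.symm_apply_apply]
  have hmono : hA.eigenvalues₀ ⟨1, hi⟩ ≤ hA.eigenvalues₀ ⟨0, by omega⟩ :=
    hA.eigenvalues₀_antitone (by simp [Fin.le_def])
  have hne : e ⟨0, by omega⟩ ≠ e ⟨1, hi⟩ := by
    intro hh
    have := e.injective hh
    simp at this
  rw [← hev, ← hev] at hmono
  have goal' : hA.eigenvalues (e ⟨1, hi⟩) ≤ c := by
    generalize e ⟨1, hi⟩ = j at *
    generalize e ⟨0, _⟩ = i at *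
    have ortho : ∀ k l, (hA.eigenvectorBasis k : V → ℝ) ⬝ᵥ (hA.eigenvectorBasis l : V → ℝ)
        = if k = l then 1 else 0 := by
      intro k l
      have := orthonormal_iff_ite.1 hA.eigenvectorBasis.orthonormal k l
      rw [EuclideanSpace.inner_eq_star_dotProduct] at this
      rw [dotProduct_comm]
      simpa using this
    have mi := hA.mulVec_eigenvectorBasis i
    have mj := hA.mulVec_eigenvectorBasis j
    have oii := ortho i i
    have ojj := ortho j j
    have oij := ortho i j
    have oji := ortho j i
    rw [if_pos rfl] at oii ojj
    rw [if_neg hne] at oij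
    rw [if_neg (Ne.symm hne)] at oji
    generalize (hA.eigenvectorBasis i : V → ℝ) = p at *
    generalize (hA.eigenvectorBasis j : V → ℝ) = q at *
    have key : ∀ a b : ℝ, a * ∑ v, p v + b * ∑ v, q v = 0 → 0 < a ^ 2 + b ^ 2 →
        hA.eigenvalues j ≤ c := by
      intro a b hab hpos
      have h1 := h (a • p + b • q) (by
        simp only [Pi.add_apply, Pi.smul_apply, smul_eq_mul, Finset.sum_add_distrib,
          ← Finset.mul_sum]
        exact hab)
      rw [mulVec_add, mulVec_smul, mulVec_smul, mi, mj] at h1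
      simp only [add_dotProduct, dotProduct_add, smul_dotProduct, dotProduct_smul, oii, ojj, oij,
        oji, smul_eq_mul] at h1
      have : hA.eigenvalues j * (a ^ 2 + b ^ 2) ≤ c * (a ^ 2 + b ^ 2) := by
        nlinarith [mul_nonneg (sub_nonneg.2 hmono) (sq_nonneg a)]
      exact le_of_mul_le_mul_right this hpos
    by_cases hz : ∑ v, p v = 0
    · exact key 1 0 (by simp [hz]) (by norm_num)
    · exact key (∑ v, q v) (-∑ v, p v) (by ring) (by
        have := sq_pos_of_ne_zero (neg_ne_zero.2 hz)
        positivity)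
  rw [hev] at goal'
  exact goal'

lemma mainC (t u s : ℝ) (hs0 : 0 ≤ s) (ht0 : 0 < t) (h₁ : (5 / 6 : ℝ) * t ≤ u)
    (h₂ : u ≤ t - 56 * s - 62) (L R β q : ℝ) (hL : 2 * u - 1 ≤ L)
    (hR : R ≤ t - u + 1 / 2) (hR0 : 0 ≤ R) (hβ : β = (t - u) / (2 * t)) (hq : q ≤ 7 / 4) :
    ∃ a c, a = (1 - 2 * β) * L + 2 * (3 - 3 * β) + 7 * (8 * s + 4 * q) ∧
      c = 2 * (2 + R) + (8 * s + 4 * q) ∧ a ≤ L ∧ c ≤ L ∧ (2 * (2 + R)) ^ 2 ≤ (L - a) * (L - c) := by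
  refine ⟨_, _, rfl, rfl, ?_⟩
  obtain ⟨d, hd⟩ : ∃ d, d = t - u := ⟨_, rfl⟩
  have h2b : 2 * β * t = d := by rw [hβ, hd]; field_simp
  have hβ0 : 0 ≤ β := by rw [hβ]; apply div_nonneg <;> linarith
  have hβ1 : 2 * β ≤ 1 / 6 := by
    by_contra hh
    push Not at hh
    nlinarith
  have e1 : 2 / 3 * d + 7 ≤ L - ((1 - 2 * β) * L + 2 * (3 - 3 * β) + 7 * (8 * s + 4 * q)) := by
    have : 2 * β * (2 * u - 1) ≤ 2 * β * L := mul_le_mul_of_nonneg_left hL (by linarith)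
    have h3 : 5 / 6 * d ≤ 2 * β * u := by
      have : 2 * β * (5 / 6 * t) ≤ 2 * β * u := mul_le_mul_of_nonneg_left h₁ (by linarith)
      linarith
    linarith
  have e2 : 15 / 2 * d - 4 ≤ L - (2 * (2 + R) + (8 * s + 4 * q)) := by
    linarith
  have hd1 : 62 ≤ d := by linarith
  refine ⟨by linarith, by linarith, ?_⟩
  calc (2 * (2 + R)) ^ 2 ≤ (2 * d + 5) ^ 2 := by
        apply pow_le_pow_left₀ (by linarith); linarith
    _ ≤ (2 / 3 * d + 7) * (15 / 2 * d - 4) := by nlinarith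
    _ ≤ _ := mul_le_mul e1 e2 (by linarith) (by linarith)

/-- The graph on `Fin 4 × I`. -/
def HGraph {I : Type*} (f : Fin 3 → Equiv.Perm I) : SimpleGraph (Fin 4 × I) where
  Adj v w := (w.1 ≠ v.1 ∧ w.1 ≠ v.1.rev) ∨
    (w.1 = v.1.rev ∧ ((v.1 < 2 ∧ ∃ k, w.2 = f k v.2) ∨ (¬ v.1 < 2 ∧ ∃ k, v.2 = f k w.2)))
  symm := ⟨by
    rintro ⟨a, i⟩ ⟨b, j⟩ h
    dsimp only at h ⊢
    rcases h with ⟨h1, h2⟩ | ⟨h1, h2⟩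
    · left
      refine ⟨h1.symm, ?_⟩
      intro h
      apply h2
      rw [h, Fin.rev_rev]
    · right
      subst h1
      refine ⟨by rw [Fin.rev_rev], ?_⟩
      have hr : ∀ a : Fin 4, a.rev < 2 ↔ ¬ a < 2 := by decide
      rw [hr]
      tauto⟩
  loopless := ⟨by
    rintro ⟨a, i⟩ h
    dsimp only at h
    have hr : ∀ a : Fin 4, a ≠ a.rev := by decide
    have := hr a
    tauto⟩

def cls (a : Fin 4) : ℝ := if a = 0 ∨ a = 3 then 1 else -1

lemma HGraph_ncard {I : Type*} [Fintype I] (f : Fin 3 → Equiv.Perm I)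
    (hf : ∀ k l i, f k i = f l i → k = l) (v : Fin 4 × I) (j : Fin 4) (hj : j ≠ v.1) :
    {w | (HGraph f).Adj v w ∧ w.1 = j}.ncard = MLift (Fintype.card I) v.1 j := by
  obtain ⟨a, i⟩ := v
  dsimp only at hj ⊢
  by_cases hr : j = a.rev
  · have hM : MLift (Fintype.card I) a j = 3 := by
      subst hr; fin_cases a <;> simp [MLift, Fin.rev]
    rw [hM]
    by_cases ha : a < 2
    · have : {w | (HGraph f).Adj (a, i) w ∧ w.1 = j} = Set.range fun k => (j, f k i) := by
        ext ⟨b, x⟩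
        simp only [HGraph, Set.mem_ofPred_eq, Set.mem_range, Prod.mk.injEq]
        constructor
        · rintro ⟨h, rfl⟩
          rcases h with h | ⟨-, ⟨-, k, hk⟩ | h⟩
          · exact absurd hr h.2
          · exact ⟨k, rfl, hk.symm⟩
          · exact absurd ha h.1
        · rintro ⟨k, rfl, h⟩
          exact ⟨Or.inr ⟨hr, Or.inl ⟨ha, k, h.symm⟩⟩, rfl⟩
      rw [this, ← Set.image_univ, Set.ncard_image_of_injective]
      · simp
      · intro k l h
        exact hf k l i (Prod.mk.inj h).2
    · have : {w | (HGraph f).Adj (a, i) w ∧ w.1 = j} = Set.range fun k => (j, (f k).symm i) := by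
        ext ⟨b, x⟩
        simp only [HGraph, Set.mem_ofPred_eq, Set.mem_range, Prod.mk.injEq]
        constructor
        · rintro ⟨h, rfl⟩
          rcases h with h | ⟨-, h | ⟨-, k, hk⟩⟩
          · exact absurd hr h.2
          · exact absurd h.1 ha
          · exact ⟨k, rfl, by rw [hk, Equiv.symm_apply_apply]⟩
        · rintro ⟨k, rfl, h⟩
          exact ⟨Or.inr ⟨hr, Or.inr ⟨ha, k, by rw [← h, Equiv.apply_symm_apply]⟩⟩, rfl⟩
      rw [this, ← Set.image_univ, Set.ncard_image_of_injective]
      · simp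
      · intro k l h
        have h2 : (f k).symm i = (f l).symm i := (Prod.mk.inj h).2
        apply hf k l ((f k).symm i)
        rw [Equiv.apply_symm_apply, h2, Equiv.apply_symm_apply]
  · have hM : MLift (Fintype.card I) a j = Fintype.card I := by
      fin_cases a <;> fin_cases j <;> simp_all [MLift, Fin.rev]
    rw [hM]
    have : {w | (HGraph f).Adj (a, i) w ∧ w.1 = j} = Set.range fun x : I => (j, x) := by
      ext ⟨b, x⟩
      simp only [HGraph, Set.mem_ofPred_eq, Set.mem_range, Prod.mk.injEq]
      constructor
      · rintro ⟨h, rfl⟩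
        exact ⟨x, rfl, rfl⟩
      · rintro ⟨k, rfl, h⟩
        exact ⟨Or.inl ⟨hj, hr⟩, rfl⟩
    rw [this, ← Set.image_univ, Set.ncard_image_of_injective]
    · simp
    · intro k l h
      exact (Prod.mk.inj h).2

lemma HGraph_conn {I : Type*} [Nonempty I] (f : Fin 3 → Equiv.Perm I) :
    (HGraph f).Connected := by
  have : ∀ v w, (HGraph f).Reachable v w := by
    rintro ⟨a, i⟩ ⟨b, j⟩
    by_cases h : b ≠ a ∧ b ≠ a.rev
    · exact SimpleGraph.Adj.reachable (Or.inl h)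
    · have hc : ∃ c : Fin 4, (c ≠ a ∧ c ≠ a.rev) ∧ (b ≠ c ∧ b ≠ c.rev) := by
        revert a b; decide
      obtain ⟨c, h1, h2⟩ := hc
      have r1 : (HGraph f).Reachable (a, i) (c, i) := SimpleGraph.Adj.reachable (Or.inl h1)
      have r2 : (HGraph f).Reachable (c, i) (b, j) := SimpleGraph.Adj.reachable (Or.inl h2)
      exact r1.trans r2
  exact { preconnected := this, nonempty := inferInstance }

open Matrix in
lemma quad_bound {V : Type*} [Fintype V] [DecidableEq V] (A B : Matrix V V ℝ) (c : V → ℝ)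
    (hB0 : ∀ v w, 0 ≤ B v w) (hBs : ∀ v w, B v w = B w v) (hB : ∀ v, ∑ w, B v w = 3)
    (hA : ∀ v w, A v w = (1 - c v * c w) / 2 + B v w) (x : V → ℝ) (hx : ∑ v, x v = 0) :
    x ⬝ᵥ (A *ᵥ x) ≤ 3 * (x ⬝ᵥ x) := by
  have e1 : x ⬝ᵥ (A *ᵥ x) = ∑ v, ∑ w, A v w * x v * x w := by
    simp only [dotProduct, mulVec, Finset.mul_sum]
    refine Finset.sum_congr rfl fun v _ => Finset.sum_congr rfl fun w _ => by ring
  have e2 : ∑ v, ∑ w, A v w * x v * x w =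
      ((∑ v, x v) * (∑ v, x v) - (∑ v, c v * x v) * (∑ v, c v * x v)) / 2
        + ∑ v, ∑ w, B v w * x v * x w := by
    rw [Finset.sum_mul_sum, Finset.sum_mul_sum, ← Finset.sum_sub_distrib, Finset.sum_div,
      ← Finset.sum_add_distrib]
    refine Finset.sum_congr rfl fun v _ => ?_
    rw [← Finset.sum_sub_distrib, Finset.sum_div, ← Finset.sum_add_distrib]
    refine Finset.sum_congr rfl fun w _ => ?_
    rw [hA]; ring
  have e3 : ∑ v, ∑ w, B v w * x v * x w ≤
      ∑ v, ∑ w, (B v w * x v ^ 2 / 2 + B v w * x w ^ 2 / 2) := by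
    refine Finset.sum_le_sum fun v _ => Finset.sum_le_sum fun w _ => ?_
    nlinarith [mul_nonneg (hB0 v w) (sq_nonneg (x v - x w))]
  have e4 : ∑ v, ∑ w, B v w * x v ^ 2 / 2 = 3 / 2 * ∑ v, x v ^ 2 := by
    rw [Finset.mul_sum]
    refine Finset.sum_congr rfl fun v _ => ?_
    rw [← Finset.sum_div, ← Finset.sum_mul, hB]; ring
  have e5 : ∑ v, ∑ w, B v w * x w ^ 2 / 2 = 3 / 2 * ∑ v, x v ^ 2 := by
    rw [Finset.sum_comm, ← e4]
    refine Finset.sum_congr rfl fun v _ => Finset.sum_congr rfl fun w _ => ?_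
    rw [hBs]
  have e6 : x ⬝ᵥ x = ∑ v, x v ^ 2 := by
    simp only [dotProduct]
    exact Finset.sum_congr rfl fun v _ => by ring
  simp only [Finset.sum_add_distrib] at e3
  rw [e1, e2, e6, hx]
  nlinarith [mul_self_nonneg (∑ v, c v * x v)]

lemma exists_lift (t : ℕ) (ht : 3 ≤ t) : ∃ (G : SimpleGraph (Fin (4 * t))) (P : Fin (4 * t) → Fin 4),
      G.Connected ∧ IsGraphLift (MLift t) G P ∧ lam (adjMat G) 2 ≤ 3 := by
  have : NeZero t := ⟨by omega⟩
  let f : Fin 3 → Equiv.Perm (ZMod t) := fun k => Equiv.addRight ((k.val : ℕ) : ZMod t)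
  have hf : ∀ k l i, f k i = f l i → k = l := by
    intro k l i h
    simp only [f, Equiv.coe_addRight, add_right_inj] at h
    rw [ZMod.natCast_eq_natCast_iff', Nat.mod_eq_of_lt (by omega), Nat.mod_eq_of_lt (by omega)] at h
    exact Fin.ext h
  let e : Fin (4 * t) ≃ Fin 4 × ZMod t := Fintype.equivOfCardEq (by simp [ZMod.card])
  let G := (HGraph f).comap e
  have hreg : ∀ (v : Fin (4 * t)) (j : Fin 4), j ≠ (e v).1 →
      {w | G.Adj v w ∧ (e w).1 = j}.ncard = MLift t (e v).1 j := by
    intro v j hj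
    have := HGraph_ncard f hf (e v) j hj
    rw [ZMod.card] at this
    rw [← this, ← Set.ncard_image_of_injective _ e.injective]
    congr 1
    ext w
    simp only [Set.mem_image, Set.mem_ofPred_eq]
    constructor
    · rintro ⟨y, hy, rfl⟩
      exact hy
    · intro h
      refine ⟨e.symm w, ?_, by simp⟩
      simpa [G] using h
  refine ⟨G, fun v => (e v).1, ?_, ⟨?_, ?_, hreg⟩, ?_⟩
  · exact (SimpleGraph.Iso.connected_iff (SimpleGraph.Iso.comap e (HGraph f))).2 (HGraph_conn f)
  · intro a
    exact ⟨e.symm (a, 0), by simp⟩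
  · intro v w h
    have h' : (HGraph f).Adj (e v) (e w) := h
    have hr : ∀ a : Fin 4, a ≠ a.rev := by decide
    rcases h' with h | h
    · exact h.1.symm
    · rw [h.1]; exact hr _
  · have hGe : ∀ v w, G.Adj v w ↔ (HGraph f).Adj (e v) (e w) := fun _ _ => Iff.rfl
    clear_value G
    classical
    have hadj : ∀ v w, adjMat G v w = if G.Adj v w then 1 else 0 := by
      intro v w
      unfold adjMat
      rw [SimpleGraph.adjMatrix_apply]
    have hsymm : ∀ v w, adjMat G v w = adjMat G w v := by
      intro v w
      simp only [hadj, G.adj_comm v w]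
    apply lam_two_le
    · ext v w
      simp [Matrix.conjTranspose_apply, hsymm w v]
    · norm_num
    have hr : ∀ a : Fin 4, a.rev ≠ a := by decide
    intro x hx
    refine quad_bound (adjMat G)
      (Matrix.of fun v w => if G.Adj v w ∧ (e w).1 = (e v).1.rev then 1 else 0)
      (fun v => cls (e v).1) ?_ ?_ ?_ ?_ x hx
    · intro v w
      simp only [Matrix.of_apply]
      split_ifs <;> norm_num
    · intro v w
      simp only [Matrix.of_apply]
      have : (e w).1 = (e v).1.rev ↔ (e v).1 = (e w).1.rev := by
        constructor <;> intro h <;> rw [h, Fin.rev_rev]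
      simp only [this, G.adj_comm v w]
    · intro v
      simp only [Matrix.of_apply]
      rw [Finset.sum_boole]
      have h3 := hreg v (e v).1.rev (hr _)
      have hM : ∀ a : Fin 4, MLift t a a.rev = 3 := by
        intro a; fin_cases a <;> simp [MLift, Fin.rev]
      rw [hM, Set.ncard_eq_toFinset_card'] at h3
      rw [← Set.toFinset_ofPred, h3]
      norm_num
    · intro v w
      rw [hadj]
      simp only [Matrix.of_apply]
      simp only [hGe]
      generalize e v = p
      generalize e w = q
      obtain ⟨a, i⟩ := p
      obtain ⟨b, j⟩ := q
      dsimp only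
      by_cases h1 : b = a.rev
      · have : cls a * cls b = 1 := by
          subst h1; fin_cases a <;> simp [cls, Fin.rev]
        rw [this]; simp [h1]
      · simp only [h1, and_false, if_false, add_zero]
        by_cases h2 : b = a
        · have hn : ¬ (HGraph f).Adj (a, i) (b, j) := by
            rintro (h | h)
            · exact h.1 h2
            · exact h1 h.1
          rw [if_neg hn]
          subst h2; unfold cls; split_ifs <;> norm_num
        · have hp : (HGraph f).Adj (a, i) (b, j) := Or.inl ⟨h2, h1⟩
          rw [if_pos hp]
          have : cls a * cls b = -1 := by
            fin_cases a <;> fin_cases b <;> simp_all [cls, Fin.rev]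
          rw [this]; norm_num

theorem stmt_15 (t u : ℕ) (hu : 0 < u) (htu : u < t) (hpar : t % 2 = u % 2)
    (h₁ : (5 / 6 : ℝ) * t ≤ (u : ℝ))
    (h₂ : (u : ℝ) ≤ (t : ℝ) - 56 * Real.sqrt t - 62) :
    lam (intToReal (MLift' u)) 1 = 2 * Real.sqrt ((u : ℝ) ^ 2 + 1) - 1 ∧
    (∃ (G : SimpleGraph (Fin (4 * t))) (P : Fin (4 * t) → Fin 4),
      G.Connected ∧ IsGraphLift (MLift t) G P ∧
      lam (adjMat G) 2 ≤ lam (intToReal (MLift' u)) 1) ∧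
    MemM (MLift t) (MLift' u) (((t : ℝ) - u) / (2 * t)) := by
  have hs0 := Real.sqrt_nonneg (t : ℝ)
  have hu1 : (1 : ℝ) ≤ u := by exact_mod_cast hu
  have htu' : (u : ℝ) < t := by exact_mod_cast htu
  have ht0 : (0 : ℝ) < t := by linarith
  have ht3 : (62 : ℝ) ≤ t := by linarith
  have hu3 : (3 : ℝ) ≤ u := by linarith
  have hL : lam (intToReal (MLift' u)) 1 = 2 * Real.sqrt ((u : ℝ) ^ 2 + 1) - 1 := by
    have hN : intToReal (MLift' u) = NMat u 1 (-3) := by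
      ext i j
      fin_cases i <;> fin_cases j <;> simp [intToReal, MLift', NMat]
    have h1 : (u : ℝ) ≤ Real.sqrt ((u : ℝ) ^ 2 + 1) := Real.le_sqrt_of_sq_le (by linarith)
    have h2 := Real.sq_sqrt (show 0 ≤ (u : ℝ) ^ 2 + 1 by positivity)
    rw [hN]
    apply NMat_lam
    · nlinarith
    all_goals linarith
  have hLge : 2 * (u : ℝ) - 1 ≤ lam (intToReal (MLift' u)) 1 := by
    rw [hL]
    have h1 : (u : ℝ) ≤ Real.sqrt ((u : ℝ) ^ 2 + 1) := Real.le_sqrt_of_sq_le (by linarith)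
    linarith
  refine ⟨hL, ?_, ?_⟩
  · obtain ⟨G, P, h1, h2, h3⟩ := exists_lift t (by omega)
    exact ⟨G, P, h1, h2, by linarith⟩
  · have hb0 : 0 < ((t : ℝ) - u) / (2 * t) := div_pos (by linarith) (by linarith)
    have hb1 : ((t : ℝ) - u) / (2 * t) ≤ 1 / 12 := by
      rw [div_le_iff₀ (by linarith)]; linarith
    have hbt : ((t : ℝ) - u) / (2 * t) * t = (t - u) / 2 := by field_simp
    refine ⟨?_, ?_, ?_, ⟨?_, ?_⟩, ⟨hb0, by linarith⟩, ?_⟩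
    · ext i j
      fin_cases i <;> fin_cases j <;> simp [MLift]
    · intro i
      fin_cases i <;> simp [MLift]
    · intro i j hij
      refine ⟨1, ?_⟩
      rw [pow_one]
      fin_cases i <;> fin_cases j <;> simp_all [MLift]
    · ext i j
      fin_cases i <;> fin_cases j <;> simp [MLift']
    · intro i j
      fin_cases i <;> fin_cases j <;> simp [MLift, MLift'] <;> omega
    · have hD : DMat (MLift t) (MLift' u) = NMat (((t : ℝ) - u) / 2) 1 3 := by
        ext i j
        fin_cases i <;> fin_cases j <;>
          simp [DMat, natToReal, intToReal, MLift, MLift', NMat] <;> ring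
      set β : ℝ := ((t : ℝ) - u) / (2 * t) with hβ
      have hAbs : absMat (DMat (MLift t) (MLift' u) - β • natToReal (MLift t)) =
          NMat 0 (1 - 3 * β) (3 - 3 * β) := by
        have a1 : |1 - β * 3| = 1 - 3 * β := by rw [abs_of_nonneg] <;> linarith
        have a2 : |3 - β * 3| = 3 - 3 * β := by rw [abs_of_nonneg] <;> linarith
        rw [hD]
        ext i j
        fin_cases i <;> fin_cases j <;>
          simp [absMat, natToReal, MLift, NMat, hbt, a1, a2]
      have hγ : lam (absMat (DMat (MLift t) (MLift' u) - β • natToReal (MLift t))) 1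
          = 3 - 3 * β := by
        rw [hAbs]
        apply NMat_lam
        · ring
        all_goals linarith
      have hR1 : Real.sqrt (1 + ((t : ℝ) - u) ^ 2) ≤ t - u + 1 / 2 := by
        apply Real.sqrt_le_iff.2
        constructor <;> nlinarith
      have hDl : lam (DMat (MLift t) (MLift' u)) 1 = 2 + Real.sqrt (1 + ((t : ℝ) - u) ^ 2) := by
        have h2 := Real.sq_sqrt (show 0 ≤ 1 + ((t : ℝ) - u) ^ 2 by positivity)
        have h1 : 1 ≤ Real.sqrt (1 + ((t : ℝ) - u) ^ 2) := Real.one_le_sqrt.2 (by nlinarith)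
        rw [hD]
        apply NMat_lam
        · nlinarith
        all_goals linarith
      have hσ : sigmaM (MLift t) = 8 * Real.sqrt t + 4 * Real.sqrt 3 := by
        simp [sigmaM, MLift, Fin.sum_univ_succ]
        ring
      have hq : Real.sqrt 3 ≤ 7 / 4 := by
        apply Real.sqrt_le_iff.2
        constructor <;> norm_num
      obtain ⟨a, c, ha, hc, g1, g2, g3⟩ := mainC t u (Real.sqrt t) hs0 ht0 h₁ h₂
        (lam (intToReal (MLift' u)) 1) (Real.sqrt (1 + ((t : ℝ) - u) ^ 2)) β (Real.sqrt 3)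
        hLge hR1 (Real.sqrt_nonneg _) hβ hq
      rw [hγ, hDl, hσ, ← ha, ← hc]
      exact two_lam _ _ _ _ (by linarith) g1 g2 g3
end

section
/- If t is a positive integer that is not a perfect square, then 2√t − 1 is not the largest eigenvalue of the adjacency matrix of any finite simple graph (that is, the spectral radius order k(2√t − 1) is infinite). -/
open Polynomial in
theorem conj_aux (t : ℕ) (p : ℤ[X]) : ∃ a b : ℤ,
    (p.map (Int.castRingHom ℝ)).eval (2 * Real.sqrt t - 1) = a + b * Real.sqrt t ∧
    (p.map (Int.castRingHom ℝ)).eval (-(2 * Real.sqrt t) - 1) = a - b * Real.sqrt t := by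
  have hs : Real.sqrt t * Real.sqrt t = t := Real.mul_self_sqrt (Nat.cast_nonneg t)
  induction p using Polynomial.induction_on with
  | C c => exact ⟨c, 0, by simp, by simp⟩
  | add p q hp hq =>
    obtain ⟨a, b, h1, h2⟩ := hp
    obtain ⟨c, d, h3, h4⟩ := hq
    refine ⟨a + c, b + d, ?_, ?_⟩
    · rw [Polynomial.map_add, eval_add, h1, h3]; push_cast; ring
    · rw [Polynomial.map_add, eval_add, h2, h4]; push_cast; ring
  | monomial n c h =>
    obtain ⟨a, b, h1, h2⟩ := h
    refine ⟨2 * b * t - a, 2 * a - b, ?_, ?_⟩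
    · rw [pow_succ, ← mul_assoc, Polynomial.map_mul, eval_mul, h1]
      simp only [map_X, eval_X]; push_cast; linear_combination (2 * (b:ℝ)) * hs
    · rw [pow_succ, ← mul_assoc, Polynomial.map_mul, eval_mul, h2]
      simp only [map_X, eval_X]; push_cast; linear_combination (2 * (b:ℝ)) * hs

open Matrix in
theorem psd_aux {n : ℕ} (A : Matrix (Fin n) (Fin n) ℝ) (hA : A.IsHermitian) (c : ℝ)
    (hc : ∀ μ, A.charpoly.IsRoot μ → μ ≤ c) : (c • (1 : Matrix (Fin n) (Fin n) ℝ) - A).PosSemidef := by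
  have hB : (c • (1 : Matrix (Fin n) (Fin n) ℝ) - A).IsHermitian := by
    refine IsHermitian.sub ?_ hA
    simp [IsHermitian]
  rw [hB.posSemidef_iff_eigenvalues_nonneg]
  intro i
  have h1 := hB.mulVec_eigenvectorBasis i
  have hv : (⇑(hB.eigenvectorBasis i) : Fin n → ℝ) ≠ 0 := by
    intro h
    have h0 := hB.eigenvectorBasis.orthonormal.ne_zero i
    apply h0
    ext j
    exact congrFun h j
  have h2 : A.charpoly.IsRoot (c - hB.eigenvalues i) := by
    rw [Polynomial.IsRoot, Matrix.eval_charpoly]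
    apply Matrix.exists_mulVec_eq_zero_iff.mp
    refine ⟨_, hv, ?_⟩
    rw [sub_mulVec, smul_mulVec, one_mulVec] at h1
    rw [sub_mulVec, scalar_apply, ← smul_one_eq_diagonal, smul_mulVec, one_mulVec, sub_smul, ← h1]
    abel
  have := hc _ h2
  simp only [Pi.zero_apply]
  linarith

open Matrix in
theorem stmt_17 (t : ℕ) (ht : 0 < t) (hsq : ¬ IsSquare t) :
    ¬ ∃ (n : ℕ) (G : SimpleGraph (Fin n)),
        lam (adjMat G) 1 = 2 * Real.sqrt t - 1 := by
  rintro ⟨n, G, h⟩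
  classical
  have hirr : Irrational (Real.sqrt t) := irrational_sqrt_natCast_iff.mpr hsq
  have ht1 : (1:ℝ) ≤ Real.sqrt t := by
    rw [Real.one_le_sqrt]; exact_mod_cast ht
  have hentry : ∀ i j, adjMat G i j = if G.Adj i j then 1 else 0 := by
    intro i j
    simp [adjMat, SimpleGraph.adjMatrix_apply]
  have hA : (adjMat G).IsHermitian := by
    ext i j
    simp [hentry, G.adj_comm]
  set A := adjMat G with hAdef
  set c := 2 * Real.sqrt t - 1 with hcdef
  have hc1 : 1 ≤ c := by linarith
  -- the largest root
  have hroot : A.charpoly.IsRoot c ∧ ∀ μ, A.charpoly.IsRoot μ → μ ≤ c := by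
    have hm : ∀ x, x ∈ eigList A ↔ A.charpoly.IsRoot x := by
      intro x
      simp [eigList, Polynomial.mem_roots A.charpoly_monic.ne_zero]
    have hs : (eigList A).Pairwise (· ≥ ·) := by
      rw [eigList, List.pairwise_reverse]
      exact Multiset.pairwise_sort _ _
    unfold lam at h
    cases hl : eigList A with
    | nil => rw [hl] at h; simp at h; linarith
    | cons a l =>
      rw [hl] at h hs hm
      simp at h
      subst h
      refine ⟨(hm _).mp (by simp), fun μ hμ => ?_⟩
      rcases List.mem_cons.mp ((hm μ).mpr hμ) with h | h
      · exact h.le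
      · exact (List.pairwise_cons.mp hs).1 μ h
  obtain ⟨hr, hmax⟩ := hroot
  let Z : Matrix (Fin n) (Fin n) ℤ := fun i j => if G.Adj i j then 1 else 0
  have hZ : A = Z.map (Int.castRingHom ℝ) := by
    ext i j
    rw [hentry, Matrix.map_apply]
    by_cases hij : G.Adj i j <;> simp [Z, hij]
  have hcp : A.charpoly = Z.charpoly.map (Int.castRingHom ℝ) := by
    rw [hZ, Matrix.charpoly_map]
  have hr2 : A.charpoly.IsRoot (-(2 * Real.sqrt t) - 1) := by
    obtain ⟨a, b, h1, h2⟩ := conj_aux t Z.charpoly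
    rw [Polynomial.IsRoot, hcp] at hr ⊢
    rw [hr] at h1
    have hb : b = 0 := by
      by_contra hb
      apply ((hirr.intCast_mul hb).intCast_add a).ne_zero
      exact h1.symm
    rw [h2]
    rw [hb] at h1 ⊢
    push_cast at h1 ⊢
    linarith
  have hpsd := psd_aux A hA c hmax
  obtain ⟨x, hx, hxA⟩ : ∃ x : Fin n → ℝ, x ≠ 0 ∧ A *ᵥ x = (-(2 * Real.sqrt t) - 1) • x := by
    rw [Polynomial.IsRoot, Matrix.eval_charpoly] at hr2
    obtain ⟨x, hx, h⟩ := Matrix.exists_mulVec_eq_zero_iff.mpr hr2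
    refine ⟨x, hx, ?_⟩
    rw [sub_mulVec, scalar_apply, ← smul_one_eq_diagonal, smul_mulVec, one_mulVec] at h
    exact (sub_eq_zero.mp h).symm
  let y : Fin n → ℝ := fun i => |x i|
  have hy := hpsd.dotProduct_mulVec_nonneg y
  rw [sub_mulVec, smul_mulVec, one_mulVec, dotProduct_sub, dotProduct_smul] at hy
  have hyy : star y ⬝ᵥ y = x ⬝ᵥ x := by
    simp [dotProduct, y]
  have hxx : 0 < x ⬝ᵥ x := by
    have h1 : 0 ≤ x ⬝ᵥ x := Finset.sum_nonneg fun i _ => mul_self_nonneg _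
    exact lt_of_le_of_ne h1 fun h => hx (dotProduct_self_eq_zero.mp h.symm)
  have h3 : -(x ⬝ᵥ A *ᵥ x) ≤ star y ⬝ᵥ A *ᵥ y := by
    simp only [dotProduct, mulVec, ← Finset.sum_neg_distrib, Finset.mul_sum]
    refine Finset.sum_le_sum fun i _ => Finset.sum_le_sum fun j _ => ?_
    simp only [hentry, y, Pi.star_apply, star_trivial]
    split_ifs
    · have := neg_abs_le (x i * x j)
      rw [abs_mul] at this
      linarith
    · simp
  rw [hxA, dotProduct_smul] at h3
  rw [hyy] at hy
  simp only [smul_eq_mul] at hy h3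
  rw [hcdef] at hy
  nlinarith
end
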